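/- Let G ≤ S_12 be the group of order 240 generated by (0 7 3 4 2)(1 9 10 8 6), (0 6)(1 7)(2 8)(3 9)(4 10)(5 11), (0 6)(1 9)(2 5)(3 7)(4 10)(8 11), and (0 1 2 ... 11). Then the center Z(G) has order 2, and the quotient G/Z(G) is isomorphic to the symmetric group S_5. -/

import Mathlib

open Equiv

/-- The fixed-point-free involution of the twelve vertices. -/
def antipode : Perm (Fin 12) :=
  c[0, 6] * c[1, 7] * c[2, 8] * c[3, 9] * c[4, 10] * c[5, 11]

/-- Five perfect matchings of the twelve vertices, permuted up to the antipode by `Aut(M₂)`. -/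
def matching : Fin 5 → Perm (Fin 12) :=
  ![c[0, 1] * c[2, 3] * c[4, 5] * c[6, 7] * c[8, 9] * c[10, 11],
    c[0, 2] * c[1, 4] * c[3, 11] * c[5, 9] * c[6, 8] * c[7, 10],
    c[0, 3] * c[1, 11] * c[2, 10] * c[4, 8] * c[5, 7] * c[6, 9],
    c[0, 4] * c[1, 3] * c[2, 5] * c[6, 10] * c[7, 9] * c[8, 11],
    c[0, 5] * c[1, 8] * c[2, 7] * c[3, 10] * c[4, 9] * c[6, 11]]

/-- `g` commutes with the antipode and permutes the matchings, up to the antipode, by `σ`. -/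
def PermutesMatchings (g : Perm (Fin 12)) (σ : Perm (Fin 5)) : Prop :=
  g * antipode = antipode * g ∧ ∀ i, g * matching i = matching (σ i) * g ∨
    g * matching i = antipode * matching (σ i) * g

instance (g : Perm (Fin 12)) (σ : Perm (Fin 5)) : Decidable (PermutesMatchings g σ) :=
  inferInstanceAs (Decidable (_ ∧ _))

lemma antipode_mul_self : antipode * antipode = 1 := by decide +kernel

lemma antipode_mul_cancel (x : Perm (Fin 12)) : antipode * (antipode * x) = x := by
  rw [← mul_assoc, antipode_mul_self, one_mul]

lemma orderOf_antipode : orderOf antipode = 2 :=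
  orderOf_eq_prime (by rw [sq, antipode_mul_self]) (by decide +kernel)

lemma commute_antipode_matching (i : Fin 5) :
    Commute antipode (matching i) := by
  revert i; unfold Commute SemiconjBy; decide +kernel

lemma eq_of_matching_eq {i j : Fin 5}
    (h : matching i = matching j ∨ matching i = antipode * matching j) : i = j := by
  revert i j; decide +kernel

namespace PermutesMatchings

variable {g h : Perm (Fin 12)} {σ τ : Perm (Fin 5)}

lemma one : PermutesMatchings 1 1 := ⟨by simp, fun i => by simp⟩

lemma mul (hg : PermutesMatchings g σ) (hh : PermutesMatchings h τ) :
    PermutesMatchings (g * h) (σ * τ) := by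
  refine ⟨by rw [mul_assoc, hh.1, ← mul_assoc, hg.1, mul_assoc], fun i => ?_⟩
  have hc (x : Perm (Fin 12)) : g * (antipode * x) = antipode * (g * x) := by
    rw [← mul_assoc, hg.1, mul_assoc]
  have h₂ := hg.2 (τ i)
  rcases hh.2 i with h₁ | h₁ <;> rcases h₂ with h₂ | h₂
  all_goals
    simp only [Perm.mul_apply, mul_assoc] at h₁ h₂ ⊢
    simp only [h₁, hc]
    rw [← mul_assoc g (matching (τ i)) h, h₂]
    simp [mul_assoc, antipode_mul_cancel]

lemma inv (hg : PermutesMatchings g σ) : PermutesMatchings g⁻¹ σ⁻¹ := by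
  have hc : g⁻¹ * antipode = antipode * g⁻¹ := by
    rw [inv_mul_eq_iff_eq_mul, ← mul_assoc, hg.1, mul_inv_cancel_right]
  refine ⟨hc, fun i => ?_⟩
  rcases hg.2 (σ⁻¹ i) with h₁ | h₁ <;> rw [← Perm.mul_apply, mul_inv_cancel, Perm.one_apply] at h₁
  · left
    rw [inv_mul_eq_iff_eq_mul, ← mul_assoc, h₁, mul_inv_cancel_right]
  · right
    rw [inv_mul_eq_iff_eq_mul, ← mul_assoc, ← mul_assoc, hg.1, mul_assoc antipode, h₁]
    simp only [mul_assoc, antipode_mul_cancel, mul_inv_cancel, mul_one]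

lemma unique (hσ : PermutesMatchings g σ) (hτ : PermutesMatchings g τ) : σ = τ := by
  ext1 i
  apply eq_of_matching_eq
  rcases hσ.2 i with h₁ | h₁ <;> rcases hτ.2 i with h₂ | h₂ <;>
    have h₃ := mul_right_cancel (h₁.symm.trans h₂)
  · exact .inl h₃
  · exact .inr h₃
  · exact .inr (by rw [← h₃, antipode_mul_cancel])
  · exact .inl (mul_left_cancel h₃)

lemma commute_sq (hg : PermutesMatchings g 1) (i j : Fin 5) :
    Commute g ((matching i * matching j) ^ 2) := by
  have key (k : Fin 5) : ∃ n : ℕ, g * matching k = antipode ^ n * (matching k * g) := by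
    rcases hg.2 k with h | h
    · exact ⟨0, by simpa using h⟩
    · exact ⟨1, by simpa [mul_assoc] using h⟩
  obtain ⟨p, hp⟩ := key i
  obtain ⟨q, hq⟩ := key j
  set a := matching i
  set b := matching j
  have hca (n : ℕ) : Commute (antipode ^ n) a := .pow_left (commute_antipode_matching i) n
  have hcb (n : ℕ) : Commute (antipode ^ n) b := .pow_left (commute_antipode_matching j) n
  have hab : g * (a * b) = antipode ^ (p + q) * (a * b) * g := by
    rw [← mul_assoc, hp, mul_assoc, mul_assoc, hq, ← mul_assoc a, ← (hca q).eq, pow_add]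
    simp only [mul_assoc]
  have hsq : (antipode ^ (p + q)) ^ 2 = 1 := by
    rw [pow_right_comm, sq antipode, antipode_mul_self, one_pow]
  have hconj : SemiconjBy g ((a * b) ^ 2) ((antipode ^ (p + q) * (a * b)) ^ 2) :=
    SemiconjBy.pow_right hab 2
  rwa [((hca _).mul_right (hcb _)).mul_pow, hsq, one_mul] at hconj

lemma eq_one_or_antipode (hg : PermutesMatchings g 1) : g = 1 ∨ g = antipode := by
  have hcomm (i j k l : Fin 5) (x : Fin 12) :
      g (((matching i * matching j) ^ 2 * (matching k * matching l) ^ 2) x) =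
        ((matching i * matching j) ^ 2 * (matching k * matching l) ^ 2) (g x) :=
    congr($((hg.commute_sq i j).mul_right (hg.commute_sq k l)) x)
  have htrans : ∀ x, ∃ i j k l : Fin 5,
      ((matching i * matching j) ^ 2 * (matching k * matching l) ^ 2) 0 = x := by
    decide +kernel
  have hfix : ∀ x, ((matching 4 * matching 0) ^ 2 * (matching 3 * matching 2) ^ 2) x = x →
      x = 0 ∨ x = antipode 0 := by
    decide +kernel
  have h₀ : g 0 = 0 ∨ g 0 = antipode 0 := by
    apply hfix
    rw [← hcomm]
    exact congrArg g (by decide +kernel)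
  refine h₀.imp (fun h => ?_) (fun h => ?_) <;> ext1 x <;>
    obtain ⟨i, j, k, l, rfl⟩ := htrans x <;> rw [hcomm, h]
  · rfl
  · have hc (i j : Fin 5) : Commute antipode ((matching i * matching j) ^ 2) :=
      ((commute_antipode_matching i).mul_right (commute_antipode_matching j)).pow_right 2
    exact congr($(((hc i j).mul_right (hc k l)).symm) 0)

end PermutesMatchings

lemma closure_cycle_swap :
    Subgroup.closure {c[0, 3, 4, 2, 1], swap (0 : Fin 5) 4} = ⊤ := by
  apply Perm.closure_prime_cycle_swap (by decide)
  · exact List.isCycle_formPerm (l := [0, 3, 4, 2, 1]) (by decide) (by decide)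
  · decide +kernel
  · exact ⟨0, 4, by decide, rfl⟩

lemma eq_one_of_commute {σ : Perm (Fin 5)} (h : ∀ τ, Commute σ τ) : σ = 1 := by
  by_contra hσ
  obtain ⟨x, hx⟩ : ∃ x, σ x ≠ x := by
    by_contra! hfix
    exact hσ (Equiv.ext hfix)
  obtain ⟨z, hzx, hzσ⟩ : ∃ z, z ≠ x ∧ z ≠ σ x :=
    (by decide : ∀ x y : Fin 5, ∃ z, z ≠ x ∧ z ≠ y) x (σ x)
  have h₁ : σ (swap x z x) = swap x z (σ x) := congr($(h (swap x z)) x)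
  rw [swap_apply_left, swap_apply_of_ne_of_ne hx hzσ.symm] at h₁
  exact hzx (σ.injective h₁)

/-- For the order-240 group G = Aut(M₂) ≤ S₁₂, the center Z(G) has order 2
and G/Z(G) ≅ S₅. -/
theorem stmt_6 :
    let g₁ : Equiv.Perm (Fin 12) := c[0, 7, 3, 4, 2] * c[1, 9, 10, 8, 6]
    let g₂ : Equiv.Perm (Fin 12) :=
      c[0, 6] * c[1, 7] * c[2, 8] * c[3, 9] * c[4, 10] * c[5, 11]
    let g₃ : Equiv.Perm (Fin 12) :=
      c[0, 6] * c[1, 9] * c[2, 5] * c[3, 7] * c[4, 10] * c[8, 11]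
    let ζ : Equiv.Perm (Fin 12) := c[0, 1, 2, 3, 4, 5, 6, 7, 8, 9, 10, 11]
    let G : Subgroup (Equiv.Perm (Fin 12)) := Subgroup.closure {g₁, g₂, g₃, ζ}
    Nat.card G = 240 ∧ Nat.card (Subgroup.center G) = 2 ∧
    ∃ f : G →* Equiv.Perm (Fin 5),
      Function.Surjective f ∧ f.ker = Subgroup.center G := by
  intro g₁ g₂ g₃ ζ G
  have h₁ : PermutesMatchings g₁ c[0, 3, 4, 2, 1] := by decide +kernel
  have h₂ : PermutesMatchings g₂ 1 := by decide +kernel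
  have h₃ : PermutesMatchings g₃ (c[0, 2] * c[1, 4]) := by decide +kernel
  have hζ : PermutesMatchings ζ (c[0, 4] * c[1, 3, 2]) := by decide +kernel
  have hζ₃ : PermutesMatchings (ζ ^ 3) (swap 0 4) := by decide +kernel
  have hG (g : G) : ∃ σ, PermutesMatchings g σ := by
    obtain ⟨g, hg⟩ := g
    induction hg using Subgroup.closure_induction with
    | mem x hx =>
      rcases hx with rfl | rfl | rfl | rfl
      exacts [⟨_, h₁⟩, ⟨_, h₂⟩, ⟨_, h₃⟩, ⟨_, hζ⟩]
    | one => exact ⟨1, .one⟩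
    | mul x y _ _ hx hy =>
      obtain ⟨σ, hσ⟩ := hx
      obtain ⟨τ, hτ⟩ := hy
      exact ⟨_, hσ.mul hτ⟩
    | inv x _ hx =>
      obtain ⟨σ, hσ⟩ := hx
      exact ⟨_, hσ.inv⟩
  choose φ hφ using hG
  let f : G →* Perm (Fin 5) :=
    MonoidHom.mk' φ fun a b => (hφ (a * b)).unique ((hφ a).mul (hφ b))
  have hf {g : G} {σ : Perm (Fin 5)} (h : PermutesMatchings g σ) : f g = σ :=
    (hφ g).unique h
  have hg₁ : g₁ ∈ G := Subgroup.subset_closure (by simp)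
  have hg₂ : g₂ ∈ G := Subgroup.subset_closure (by simp)
  have hζG : ζ ∈ G := Subgroup.subset_closure (by simp)
  have hsurj : Function.Surjective f := by
    rw [← MonoidHom.range_eq_top, eq_top_iff, ← closure_cycle_swap, Subgroup.closure_le]
    rintro σ (rfl | rfl)
    · exact ⟨⟨g₁, hg₁⟩, hf h₁⟩
    · exact ⟨⟨ζ ^ 3, pow_mem hζG 3⟩, hf hζ₃⟩
  have hmem (g : G) : f g = 1 ↔ g = 1 ∨ g = ⟨g₂, hg₂⟩ := by
    refine ⟨fun h => ?_, ?_⟩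
    · have hg : PermutesMatchings g 1 := (show φ g = 1 from h) ▸ hφ g
      have hcases : (g : Perm (Fin 12)) = 1 ∨ (g : Perm (Fin 12)) = g₂ :=
        hg.eq_one_or_antipode
      exact hcases.imp (fun h => Subtype.ext h) (fun h => Subtype.ext h)
    · rintro (rfl | rfl)
      exacts [map_one f, hf h₂]
  have hker : f.ker = Subgroup.center G := by
    ext g
    rw [MonoidHom.mem_ker]
    refine ⟨fun h => ?_, fun h => ?_⟩
    · rcases (hmem g).1 h with rfl | rfl
      · exact one_mem _
      · refine Subgroup.mem_center_iff.2 fun x => Subtype.ext ?_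
        have hx : (x : Perm (Fin 12)) * g₂ = g₂ * x := (hφ x).1
        exact hx
    · apply eq_one_of_commute
      intro σ
      obtain ⟨x, rfl⟩ := hsurj σ
      exact (show Commute g x from (Subgroup.mem_center_iff.1 h x).symm).map f
  have hcard : Nat.card (Subgroup.center G) = 2 := by
    have : f.ker = Subgroup.zpowers ⟨g₂, hg₂⟩ := by
      ext g
      rw [MonoidHom.mem_ker, hmem]
      refine ⟨?_, fun h => ?_⟩
      · rintro (rfl | rfl)
        exacts [one_mem _, Subgroup.mem_zpowers _]
      · rw [← hmem, ← MonoidHom.mem_ker]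
        exact Subgroup.zpowers_le.2 (MonoidHom.mem_ker.2 ((hmem _).2 (.inr rfl))) h
    rw [← hker, this, Nat.card_zpowers, Subgroup.orderOf_mk]
    exact orderOf_antipode
  refine ⟨?_, hcard, f, hsurj, hker⟩
  rw [← f.ker.card_mul_index, hker, hcard, ← hker, Subgroup.index_ker,
    MonoidHom.range_eq_top.2 hsurj, Subgroup.card_top, Nat.card_perm]
  simp [Nat.factorial]
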